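/- There exist positive real constants c and C, independent of the weight, such that for every weight w and every interval J ⊂ ℝ with ⟨w log w⟩_J finite: c ( ⟨w log w⟩_J − ⟨w⟩_J log ⟨w⟩_J ) ≤ (1/|J|) Σ_{I ∈ 𝒟(J)} (Δ_I w / ⟨w⟩_I)² ⟨w⟩_I |I| ≤ C ( ⟨w log w⟩_J − ⟨w⟩_J log ⟨w⟩_J ). -/

import Mathlib

open MeasureTheory Real
open scoped ENNReal

noncomputable section

/-- The average `⟨w⟩_{[a,b]} = (b-a)⁻¹ ∫_a^b w`. -/
def avg (w : ℝ → ℝ) (a b : ℝ) : ℝ := (b - a)⁻¹ * ∫ x in a..b, w x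

/-- A weight: a locally integrable function on `ℝ` that is positive almost everywhere. -/
def IsWeight (w : ℝ → ℝ) : Prop :=
  LocallyIntegrable w volume ∧ ∀ᵐ x : ℝ, 0 < w x

/-- Endpoints of the `k`-th subinterval of `[a,b]` at bisection level `n`; as `n, k` range over
`n : ℕ`, `k < 2^n` these enumerate the family `𝒟(J)` obtained from `J = [a,b]` by repeated
bisection (including `J` itself, for `n = 0`). -/
def subInt (a b : ℝ) (n k : ℕ) : ℝ × ℝ :=
  (a + k * ((b - a) / 2 ^ n), a + (k + 1) * ((b - a) / 2 ^ n))

/-- Midpoint of an interval. -/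
def mid (a b : ℝ) : ℝ := (a + b) / 2

/-- `Δ_I w` for `I = [a,b]`: the difference of the averages of `w` over the two halves of `I`. -/
def delta (w : ℝ → ℝ) (a b : ℝ) : ℝ := avg w a (mid a b) - avg w (mid a b) b

/-- `(1/|J|) Σ_{I ∈ 𝒟(J)} (Δ_I w)² g(⟨w⟩_I) |I|` for `J = [a,b]`. -/
def bellmanSum (w : ℝ → ℝ) (a b : ℝ) (g : ℝ → ℝ) : ℝ :=
  (b - a)⁻¹ * ∑' n : ℕ, ∑ k ∈ Finset.range (2 ^ n),
    delta w (subInt a b n k).1 (subInt a b n k).2 ^ 2 *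
      g (avg w (subInt a b n k).1 (subInt a b n k).2) * ((b - a) / 2 ^ n)

/-- `(1/|J|) Σ_{I ∈ 𝒟(J)} (Δ_I w / ⟨w⟩_I)² g(⟨w⟩_I) |I|` for `J = [a,b]`. -/
def buckleySum (w : ℝ → ℝ) (a b : ℝ) (g : ℝ → ℝ) : ℝ :=
  (b - a)⁻¹ * ∑' n : ℕ, ∑ k ∈ Finset.range (2 ^ n),
    (delta w (subInt a b n k).1 (subInt a b n k).2 /
        avg w (subInt a b n k).1 (subInt a b n k).2) ^ 2 *
      g (avg w (subInt a b n k).1 (subInt a b n k).2) * ((b - a) / 2 ^ n)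

/-- `ℝ≥0∞`-valued version of `buckleySum` (the summands are nonnegative). -/
def buckleySumE (w : ℝ → ℝ) (a b : ℝ) (g : ℝ → ℝ) : ℝ≥0∞ :=
  ENNReal.ofReal ((b - a)⁻¹) * ∑' n : ℕ, ∑ k ∈ Finset.range (2 ^ n),
    ENNReal.ofReal
      ((delta w (subInt a b n k).1 (subInt a b n k).2 /
          avg w (subInt a b n k).1 (subInt a b n k).2) ^ 2 *
        g (avg w (subInt a b n k).1 (subInt a b n k).2) * ((b - a) / 2 ^ n))

/-- `w` is doubling with constant `D` on the bisection family of `[a,b]`: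
`⟨w⟩_I ≤ D ⟨w⟩_{I⁺}` and `⟨w⟩_I ≤ D ⟨w⟩_{I⁻}` for every `I ∈ 𝒟(J)` (including `I = J`). -/
def DoublingOn (D : ℝ) (w : ℝ → ℝ) (a b : ℝ) : Prop :=
  ∀ n : ℕ, ∀ k < 2 ^ n,
    avg w (subInt a b n k).1 (subInt a b n k).2 ≤
        D * avg w (subInt a b n k).1 (mid (subInt a b n k).1 (subInt a b n k).2) ∧
      avg w (subInt a b n k).1 (subInt a b n k).2 ≤
        D * avg w (mid (subInt a b n k).1 (subInt a b n k).2) (subInt a b n k).2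

/-- Endpoints of the dyadic interval `[k·2^{-j}, (k+1)·2^{-j})` of the grid `𝒟`. -/
def dyad (j k : ℤ) : ℝ × ℝ := ((k : ℝ) * (2 : ℝ) ^ (-j), ((k : ℝ) + 1) * (2 : ℝ) ^ (-j))

/-- `w` is dyadically doubling with constant `D`: the average over any dyadic interval is at most
`D` times the average over each of its two dyadic children, i.e. `⟨w⟩_{F(I)} ≤ D ⟨w⟩_I` for every
`I ∈ 𝒟` with dyadic parent `F(I)`. -/
def DyadicDoubling (D : ℝ) (w : ℝ → ℝ) : Prop :=
  ∀ j k : ℤ,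
    avg w (dyad j k).1 (dyad j k).2 ≤
        D * avg w (dyad (j + 1) (2 * k)).1 (dyad (j + 1) (2 * k)).2 ∧
      avg w (dyad j k).1 (dyad j k).2 ≤
        D * avg w (dyad (j + 1) (2 * k + 1)).1 (dyad (j + 1) (2 * k + 1)).2

/-- The function `x log x` lies above each of its tangent lines. -/
lemma tangent_le_mul_log {m y : ℝ} (hm : 0 < m) (hy : 0 < y) :
    y * (1 + log m) - m ≤ y * log y := by
  have h := Real.log_le_sub_one_of_pos (div_pos hm hy)
  rw [Real.log_div hm.ne' hy.ne'] at h
  have h2 := mul_le_mul_of_nonneg_left h hy.le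
  have : y * (m / y - 1) = m - y := by field_simp
  rw [this] at h2
  linarith

lemma neg_one_le_mul_log {y : ℝ} (hy : 0 < y) : -1 ≤ y * log y := by
  have := tangent_le_mul_log one_pos hy
  rw [Real.log_one] at this
  linarith

lemma sub_one_sq_le_mul_log {x : ℝ} (hx : 0 < x) (hx2 : x ≤ 2) :
    (x - 1) ^ 2 / 6 ≤ x * log x - x + 1 := by
  obtain ⟨s, hs, rfl⟩ : ∃ s : ℝ, 0 < s ∧ x = s ^ 2 :=
    ⟨√x, Real.sqrt_pos.2 hx, (Real.sq_sqrt hx.le).symm⟩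
  have h := Real.one_sub_inv_le_log_of_pos hs
  have h2 := mul_le_mul_of_nonneg_left h (by positivity : 0 ≤ 2 * s ^ 2)
  have h3 : 2 * s ^ 2 * (1 - s⁻¹) = 2 * s ^ 2 - 2 * s := by field_simp
  rw [h3] at h2
  rw [Real.log_pow]
  push_cast
  have hs3 : s ≤ 1.42 := by nlinarith
  have : (s ^ 2 - 1) ^ 2 / 6 ≤ (s - 1) ^ 2 := by
    have : (s ^ 2 - 1) ^ 2 = (s - 1) ^ 2 * (s + 1) ^ 2 := by ring
    have h6 : (s + 1) ^ 2 ≤ 6 := by nlinarith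
    nlinarith [mul_le_mul_of_nonneg_left h6 (sq_nonneg (s - 1))]
  linarith

/-- The Jensen gap of `x log x` for two equal masses is comparable to `(p - q)² / ((p + q) / 2)`. -/
lemma jensen_gap_mul_log {p q : ℝ} (hp : 0 < p) (hq : 0 < q) :
    4 * ((p * log p + q * log q) / 2 - (p + q) / 2 * log ((p + q) / 2)) ≤
        ((p - q) / ((p + q) / 2)) ^ 2 * ((p + q) / 2) ∧
      ((p - q) / ((p + q) / 2)) ^ 2 * ((p + q) / 2) ≤
        24 * ((p * log p + q * log q) / 2 - (p + q) / 2 * log ((p + q) / 2)) := by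
  obtain ⟨m, hm⟩ : ∃ m, m = (p + q) / 2 := ⟨_, rfl⟩
  have hm0 : 0 < m := by rw [hm]; positivity
  obtain ⟨x, rfl⟩ : ∃ x, p = m * x := ⟨p / m, by field_simp⟩
  obtain ⟨y, rfl⟩ : ∃ y, q = m * y := ⟨q / m, by field_simp⟩
  have hx : 0 < x := pos_of_mul_pos_right hp hm0.le
  have hy : 0 < y := pos_of_mul_pos_right hq hm0.le
  have hxy : x + y = 2 := by
    have : m * (x + y - 2) = 0 := by linarith
    rcases mul_eq_zero.1 this with h | h <;> linarith
  rw [← hm, Real.log_mul hm0.ne' hx.ne', Real.log_mul hm0.ne' hy.ne']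
  have e1 : ((m * x - m * y) / m) ^ 2 * m = m * (x - y) ^ 2 := by field_simp
  have e2 : (m * x * (log m + log x) + m * y * (log m + log y)) / 2 - m * log m =
      m * ((x * log x + y * log y) / 2) := by
    have : y = 2 - x := by linarith
    subst this
    ring
  rw [e1, e2]
  have hy2 : y = 2 - x := by linarith
  have u1 := mul_le_mul_of_nonneg_left (Real.log_le_sub_one_of_pos hx) hx.le
  have u2 := mul_le_mul_of_nonneg_left (Real.log_le_sub_one_of_pos hy) hy.le
  have l1 := sub_one_sq_le_mul_log hx (by linarith)
  have l2 := sub_one_sq_le_mul_log hy (by linarith)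
  subst hy2
  constructor
  · have : 4 * ((x * log x + (2 - x) * log (2 - x)) / 2) ≤ (x - (2 - x)) ^ 2 := by nlinarith
    nlinarith [mul_le_mul_of_nonneg_left this hm0.le]
  · have : (x - (2 - x)) ^ 2 ≤ 24 * ((x * log x + (2 - x) * log (2 - x)) / 2) := by nlinarith
    nlinarith [mul_le_mul_of_nonneg_left this hm0.le]

lemma sum_range_two_mul (f : ℕ → ℝ) (m : ℕ) :
    ∑ i ∈ Finset.range (2 * m), f i = ∑ k ∈ Finset.range m, (f (2 * k) + f (2 * k + 1)) := by
  induction m with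
  | zero => simp
  | succ m ih =>
    rw [Finset.sum_range_succ, ← ih, Nat.mul_succ, Finset.sum_range_succ, Finset.sum_range_succ,
      add_assoc]

lemma IsWeight.intervalIntegrable {w : ℝ → ℝ} (hw : IsWeight w) (a b : ℝ) :
    IntervalIntegrable w volume a b :=
  (hw.1.integrableOn_isCompact isCompact_uIcc).intervalIntegrable

lemma IsWeight.avg_pos {w : ℝ → ℝ} (hw : IsWeight w) {a b : ℝ} (hab : a < b) :
    0 < avg w a b := by
  refine mul_pos (inv_pos.2 (sub_pos.2 hab)) ?_
  have hpos : ∀ᵐ x ∂volume.restrict (Set.Ioc a b), 0 < w x := ae_restrict_of_ae hw.2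
  rw [intervalIntegral.integral_of_le hab.le,
    integral_pos_iff_support_of_nonneg_ae (hpos.mono fun _ h => h.le) (hw.intervalIntegrable a b).1]
  have : Function.support w =ᵐ[volume.restrict (Set.Ioc a b)] (Set.univ : Set ℝ) := by
    filter_upwards [hpos] with x hx
    exact propext ⟨fun _ => trivial, fun _ => hx.ne'⟩
  rw [measure_congr this]
  simpa using hab

/-- The average of the averages over the two halves is the average. -/
lemma IsWeight.avg_eq_add_div_two {w : ℝ → ℝ} (hw : IsWeight w) {a b : ℝ} (hab : a < b) :
    avg w a b = (avg w a (mid a b) + avg w (mid a b) b) / 2 := by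
  have h1 : mid a b - a = (b - a) / 2 := by unfold mid; ring
  have h2 : b - mid a b = (b - a) / 2 := by unfold mid; ring
  have := (sub_pos.2 hab).ne'
  unfold avg
  rw [h1, h2, ← intervalIntegral.integral_add_adjacent_intervals
    (hw.intervalIntegrable a (mid a b)) (hw.intervalIntegrable (mid a b) b)]
  field_simp

lemma IsWeight.avg_mul_log_avg_le {w : ℝ → ℝ} (hw : IsWeight w) {a b : ℝ} (hab : a < b)
    (hi : IntervalIntegrable (fun x => w x * log (w x)) volume a b) :
    avg w a b * log (avg w a b) * (b - a) ≤ ∫ x in a..b, w x * log (w x) := by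
  have hm := hw.avg_pos hab
  have hint : ∫ x in a..b, w x = avg w a b * (b - a) := by
    have := (sub_pos.2 hab).ne'
    unfold avg
    field_simp
  have hwi := (hw.intervalIntegrable a b).mul_const (1 + log (avg w a b))
  have h := intervalIntegral.integral_mono_ae hab.le
    (hwi.sub (intervalIntegrable_const (c := avg w a b))) hi
    (hw.2.mono fun x hx => tangent_le_mul_log hm hx)
  rw [intervalIntegral.integral_sub hwi intervalIntegrable_const,
    intervalIntegral.integral_mul_const, intervalIntegral.integral_const, hint, smul_eq_mul] at h
  linarith

lemma subInt_fst_lt_snd {a b : ℝ} (hab : a < b) (n k : ℕ) :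
    (subInt a b n k).1 < (subInt a b n k).2 := by
  have : 0 < (b - a) / 2 ^ n := div_pos (sub_pos.2 hab) (by positivity)
  simp only [subInt]
  linarith

lemma subInt_snd_eq (a b : ℝ) (n k : ℕ) : (subInt a b n k).2 = (subInt a b n (k + 1)).1 := by
  simp [subInt]

lemma subInt_snd_sub_fst (a b : ℝ) (n k : ℕ) :
    (subInt a b n k).2 - (subInt a b n k).1 = (b - a) / 2 ^ n := by
  simp only [subInt]
  ring

lemma subInt_succ_two_mul (a b : ℝ) (n k : ℕ) :
    subInt a b (n + 1) (2 * k) =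
      ((subInt a b n k).1, mid (subInt a b n k).1 (subInt a b n k).2) := by
  simp only [subInt, mid, Prod.mk.injEq, pow_succ]
  push_cast
  exact ⟨by field_simp, by field_simp; ring⟩

lemma subInt_succ_two_mul_add_one (a b : ℝ) (n k : ℕ) :
    subInt a b (n + 1) (2 * k + 1) =
      (mid (subInt a b n k).1 (subInt a b n k).2, (subInt a b n k).2) := by
  simp only [subInt, mid, Prod.mk.injEq, pow_succ]
  push_cast
  constructor <;> field_simp <;> ring

lemma subInt_mem_Icc {a b : ℝ} (hab : a < b) (n : ℕ) {k : ℕ} (hk : k ≤ 2 ^ n) :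
    (subInt a b n k).1 ∈ Set.Icc a b := by
  have h : 0 < b - a := sub_pos.2 hab
  have hk' : (k : ℝ) ≤ 2 ^ n := by exact_mod_cast hk
  have h2 : (k : ℝ) * ((b - a) / 2 ^ n) ≤ 2 ^ n * ((b - a) / 2 ^ n) := by gcongr
  have h3 : (2 : ℝ) ^ n * ((b - a) / 2 ^ n) = b - a := by field_simp
  have h4 : 0 ≤ (k : ℝ) * ((b - a) / 2 ^ n) := by positivity
  simp only [subInt, Set.mem_Icc]
  constructor <;> linarith

lemma subInt_zero_fst (a b : ℝ) (n : ℕ) : (subInt a b n 0).1 = a := by simp [subInt]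

lemma subInt_two_pow_fst (a b : ℝ) (n : ℕ) : (subInt a b n (2 ^ n)).1 = b := by
  simp only [subInt]
  push_cast
  field_simp
  ring

/-- A family of integrals over the subintervals of one level adds up to the integral over `[a,b]`. -/
lemma sum_integral_subInt {f : ℝ → ℝ} (a b : ℝ) (n : ℕ)
    (hf : ∀ k < 2 ^ n, IntervalIntegrable f volume (subInt a b n k).1 (subInt a b n k).2) :
    IntervalIntegrable f volume a b ∧
      ∑ k ∈ Finset.range (2 ^ n), ∫ x in (subInt a b n k).1..(subInt a b n k).2, f x =
        ∫ x in a..b, f x := by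
  simp only [subInt_snd_eq] at hf ⊢
  have h1 := IntervalIntegrable.trans_iterate (a := fun k => (subInt a b n k).1) hf
  have h2 := intervalIntegral.sum_integral_adjacent_intervals
    (a := fun k => (subInt a b n k).1) hf
  simp only [subInt_zero_fst, subInt_two_pow_fst] at h1 h2
  exact ⟨h1, h2⟩

/-- `∑ ⟨w⟩_I log ⟨w⟩_I |I|` over the subintervals `I` of the `n`-th level. -/
def levelSum (w : ℝ → ℝ) (a b : ℝ) (n : ℕ) : ℝ :=
  ∑ k ∈ Finset.range (2 ^ n),
    avg w (subInt a b n k).1 (subInt a b n k).2 *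
      log (avg w (subInt a b n k).1 (subInt a b n k).2) * ((b - a) / 2 ^ n)

/-- The contribution of the `n`-th level to `buckleySum w a b (fun x => x)`. -/
def buckleyLevel (w : ℝ → ℝ) (a b : ℝ) (n : ℕ) : ℝ :=
  ∑ k ∈ Finset.range (2 ^ n),
    (delta w (subInt a b n k).1 (subInt a b n k).2 /
        avg w (subInt a b n k).1 (subInt a b n k).2) ^ 2 *
      avg w (subInt a b n k).1 (subInt a b n k).2 * ((b - a) / 2 ^ n)

lemma levelSum_zero (w : ℝ → ℝ) (a b : ℝ) :
    levelSum w a b 0 = avg w a b * log (avg w a b) * (b - a) := by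
  simp [levelSum, subInt]

lemma IsWeight.buckleyLevel_nonneg {w : ℝ → ℝ} (hw : IsWeight w) {a b : ℝ} (hab : a < b) (n : ℕ) :
    0 ≤ buckleyLevel w a b n :=
  Finset.sum_nonneg fun k _ => mul_nonneg (mul_nonneg (sq_nonneg _)
    (hw.avg_pos (subInt_fst_lt_snd hab n k)).le) (div_nonneg (sub_pos.2 hab).le (by positivity))

lemma IsWeight.buckleyLevel_bounds {w : ℝ → ℝ} (hw : IsWeight w) {a b : ℝ} (hab : a < b) (n : ℕ) :
    4 * (levelSum w a b (n + 1) - levelSum w a b n) ≤ buckleyLevel w a b n ∧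
      buckleyLevel w a b n ≤ 24 * (levelSum w a b (n + 1) - levelSum w a b n) := by
  have hl : 0 ≤ (b - a) / 2 ^ n := div_nonneg (sub_pos.2 hab).le (by positivity)
  have key : ∀ k, _ := fun k : ℕ =>
    have hlt := subInt_fst_lt_snd hab n k
    jensen_gap_mul_log
      (hw.avg_pos (show (subInt a b n k).1 < mid (subInt a b n k).1 (subInt a b n k).2 by
        unfold mid; linarith))
      (hw.avg_pos (show mid (subInt a b n k).1 (subInt a b n k).2 < (subInt a b n k).2 by
        unfold mid; linarith))
  simp only [← hw.avg_eq_add_div_two (subInt_fst_lt_snd hab n _)] at key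
  unfold levelSum buckleyLevel
  rw [pow_succ' 2 n, sum_range_two_mul, ← Finset.sum_sub_distrib, Finset.mul_sum, Finset.mul_sum]
  have e : (b - a) / (2 * 2 ^ n) = (b - a) / 2 ^ n / 2 := by field_simp
  constructor <;> refine Finset.sum_le_sum fun k _ => ?_ <;>
    rw [pow_succ' (2 : ℝ) n, e, subInt_succ_two_mul, subInt_succ_two_mul_add_one]
  · have := mul_le_mul_of_nonneg_right (key k).1 hl
    simp only [delta]
    linarith
  · have := mul_le_mul_of_nonneg_right (key k).2 hl
    simp only [delta]
    linarith

lemma IsWeight.sum_buckleyLevel_bounds {w : ℝ → ℝ} (hw : IsWeight w) {a b : ℝ} (hab : a < b)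
    (n : ℕ) :
    4 * (levelSum w a b n - levelSum w a b 0) ≤ ∑ i ∈ Finset.range n, buckleyLevel w a b i ∧
      ∑ i ∈ Finset.range n, buckleyLevel w a b i ≤
        24 * (levelSum w a b n - levelSum w a b 0) := by
  rw [← Finset.sum_range_sub, Finset.mul_sum, Finset.mul_sum]
  exact ⟨Finset.sum_le_sum fun i _ => (hw.buckleyLevel_bounds hab i).1,
    Finset.sum_le_sum fun i _ => (hw.buckleyLevel_bounds hab i).2⟩

lemma IsWeight.levelSum_le {w : ℝ → ℝ} (hw : IsWeight w) {a b : ℝ} (hab : a < b)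
    (hi : IntervalIntegrable (fun x => w x * log (w x)) volume a b) (n : ℕ) :
    levelSum w a b n ≤ ∫ x in a..b, w x * log (w x) := by
  have hik : ∀ k < 2 ^ n, IntervalIntegrable (fun x => w x * log (w x)) volume
      (subInt a b n k).1 (subInt a b n k).2 := fun k hk => by
    refine hi.mono_set ?_
    rw [Set.uIcc_of_le hab.le]
    refine Set.uIcc_subset_Icc (subInt_mem_Icc hab n hk.le) ?_
    rw [subInt_snd_eq]
    exact subInt_mem_Icc hab n hk
  rw [← (sum_integral_subInt a b n hik).2]
  refine Finset.sum_le_sum fun k hk => ?_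
  rw [← subInt_snd_sub_fst a b n k]
  exact hw.avg_mul_log_avg_le (subInt_fst_lt_snd hab n k) (hik k (Finset.mem_range.1 hk))

/-- The conditional expectation of `w` with respect to the `n`-th level of bisection of `[a,b]`. -/
def levelAvg (w : ℝ → ℝ) (a b : ℝ) (n : ℕ) (x : ℝ) : ℝ :=
  avg w (subInt a b n ⌊(x - a) / ((b - a) / 2 ^ n)⌋₊).1
    (subInt a b n ⌊(x - a) / ((b - a) / 2 ^ n)⌋₊).2

lemma measurable_levelAvg (w : ℝ → ℝ) (a b : ℝ) (n : ℕ) : Measurable (levelAvg w a b n) :=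
  (measurable_from_nat (f := fun k => avg w (subInt a b n k).1 (subInt a b n k).2)).comp
    (Nat.measurable_floor.comp (by fun_prop))

lemma levelAvg_eq {a b : ℝ} (hab : a < b) (w : ℝ → ℝ) (n k : ℕ) {x : ℝ}
    (hx : x ∈ Set.Ico (subInt a b n k).1 (subInt a b n k).2) :
    levelAvg w a b n x = avg w (subInt a b n k).1 (subInt a b n k).2 := by
  have hl : 0 < (b - a) / 2 ^ n := div_pos (sub_pos.2 hab) (by positivity)
  have : ⌊(x - a) / ((b - a) / 2 ^ n)⌋₊ = k := by
    simp only [subInt, Set.mem_Ico] at hx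
    rw [Nat.floor_eq_iff (div_nonneg (by nlinarith [mul_nonneg k.cast_nonneg hl.le]) hl.le),
      le_div_iff₀ hl, div_lt_iff₀ hl]
    constructor <;> linarith
  rw [levelAvg, this]

lemma integral_levelAvg_mul_log {a b : ℝ} (hab : a < b) (w : ℝ → ℝ) (n : ℕ) :
    IntervalIntegrable (fun x => levelAvg w a b n x * log (levelAvg w a b n x)) volume a b ∧
      ∫ x in a..b, levelAvg w a b n x * log (levelAvg w a b n x) = levelSum w a b n := by
  have hae : ∀ k, ∀ᵐ x ∂volume.restrict (Set.uIoc (subInt a b n k).1 (subInt a b n k).2),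
      avg w (subInt a b n k).1 (subInt a b n k).2 *
        log (avg w (subInt a b n k).1 (subInt a b n k).2) =
      levelAvg w a b n x * log (levelAvg w a b n x) := fun k => by
    rw [Set.uIoc_of_le (subInt_fst_lt_snd hab n k).le, ← restrict_Ico_eq_restrict_Ioc]
    filter_upwards [ae_restrict_mem measurableSet_Ico] with x hx
    rw [levelAvg_eq hab w n k hx]
  obtain ⟨h1, h2⟩ := sum_integral_subInt (f := fun x => levelAvg w a b n x *
    log (levelAvg w a b n x)) a b n fun k _ =>
      (intervalIntegrable_const (μ := volume)).congr_ae (hae k)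
  refine ⟨h1, ?_⟩
  rw [← h2]
  refine Finset.sum_congr rfl fun k _ => ?_
  rw [← intervalIntegral.integral_congr_ae_restrict (hae k), intervalIntegral.integral_const,
    subInt_snd_sub_fst, smul_eq_mul, mul_comm]

lemma mem_subInt_floor {a b : ℝ} (hab : a < b) (n : ℕ) {x : ℝ} (hx : a ≤ x) :
    x ∈ Set.Icc (subInt a b n ⌊(x - a) / ((b - a) / 2 ^ n)⌋₊).1
      (subInt a b n ⌊(x - a) / ((b - a) / 2 ^ n)⌋₊).2 := by
  have hl : 0 < (b - a) / 2 ^ n := div_pos (sub_pos.2 hab) (by positivity)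
  have h1 := Nat.floor_le (div_nonneg (sub_nonneg.2 hx) hl.le)
  have h2 := (Nat.lt_floor_add_one ((x - a) / ((b - a) / 2 ^ n))).le
  rw [le_div_iff₀ hl] at h1
  rw [div_le_iff₀ hl] at h2
  simp only [subInt, Set.mem_Icc]
  constructor <;> linarith

/-- Lebesgue differentiation along the bisection family. -/
lemma IsWeight.ae_tendsto_levelAvg {w : ℝ → ℝ} (hw : IsWeight w) {a b : ℝ} (hab : a < b) :
    ∀ᵐ x : ℝ, a ≤ x → Filter.Tendsto (fun n => levelAvg w a b n x) Filter.atTop (nhds (w x)) := by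
  filter_upwards [IsUnifLocDoublingMeasure.ae_tendsto_average (μ := (volume : Measure ℝ)) hw.1 1]
    with x hx hax
  have hl : ∀ n : ℕ, 0 < (b - a) / 2 ^ n := fun n => div_pos (sub_pos.2 hab) (by positivity)
  set I : ℕ → ℝ × ℝ := fun n => subInt a b n ⌊(x - a) / ((b - a) / 2 ^ n)⌋₊ with hI
  have hlen : ∀ n, (I n).2 - (I n).1 = (b - a) / 2 ^ n := fun n => subInt_snd_sub_fst _ _ _ _
  have hball : ∀ n, Metric.closedBall (mid (I n).1 (I n).2) ((b - a) / 2 ^ n / 2) =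
      Set.Icc (I n).1 (I n).2 := fun n => by
    rw [Real.closedBall_eq_Icc, ← hlen n]
    unfold mid
    congr 1 <;> ring
  have hδ : Filter.Tendsto (fun n : ℕ => (b - a) / 2 ^ n / 2) Filter.atTop
      (nhdsWithin 0 (Set.Ioi 0)) := by
    refine tendsto_nhdsWithin_iff.2 ⟨?_, Filter.Eventually.of_forall fun n => half_pos (hl n)⟩
    have := (tendsto_pow_atTop_nhds_zero_of_lt_one (r := (1 / 2 : ℝ)) (by norm_num)
      (by norm_num)).const_mul ((b - a) / 2)
    rw [mul_zero] at this
    refine this.congr fun n => ?_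
    rw [div_pow, one_pow]
    ring
  refine (hx (fun n => mid (I n).1 (I n).2) _ hδ (Filter.Eventually.of_forall fun n => ?_)).congr
    fun n => ?_
  · rw [one_mul, hball]
    exact mem_subInt_floor hab n hax
  · have hle : (I n).1 ≤ (I n).2 := by linarith [hlen n, hl n]
    rw [hball, setAverage_eq, smul_eq_mul, Real.volume_real_Icc_of_le hle,
      integral_Icc_eq_integral_Ioc, ← intervalIntegral.integral_of_le hle]
    rfl

/-- Fatou's lemma for the level sums. -/
lemma IsWeight.integral_mul_log_le {w : ℝ → ℝ} (hw : IsWeight w) {a b : ℝ} (hab : a < b)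
    (hi : IntervalIntegrable (fun x => w x * log (w x)) volume a b) {B : ℝ}
    (hB : ∀ n, levelSum w a b n ≤ B) :
    ∫ x in a..b, w x * log (w x) ≤ B := by
  have hpos : ∀ n x, 0 ≤ levelAvg w a b n x * log (levelAvg w a b n x) + 1 := fun n x => by
    linarith [neg_one_le_mul_log (y := levelAvg w a b n x)
      (hw.avg_pos (subInt_fst_lt_snd hab n _))]
  have hlevel : ∀ n, ∫⁻ x in Set.Ioc a b,
      ENNReal.ofReal (levelAvg w a b n x * log (levelAvg w a b n x) + 1) ≤
        ENNReal.ofReal (B + (b - a)) := fun n => by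
    obtain ⟨h1, h2⟩ := integral_levelAvg_mul_log hab w n
    have h3 := h1.add (intervalIntegrable_const (c := (1 : ℝ)))
    rw [← ofReal_integral_eq_lintegral_ofReal h3.1 (Filter.Eventually.of_forall (hpos n))]
    refine ENNReal.ofReal_le_ofReal ?_
    rw [← intervalIntegral.integral_of_le hab.le,
      intervalIntegral.integral_add h1 intervalIntegrable_const, h2]
    simpa using hB n
  have hlim : ∀ᵐ x ∂volume.restrict (Set.Ioc a b),
      ENNReal.ofReal (w x * log (w x) + 1) = Filter.liminf (fun n => ENNReal.ofReal
        (levelAvg w a b n x * log (levelAvg w a b n x) + 1)) Filter.atTop := by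
    filter_upwards [ae_restrict_of_ae (hw.ae_tendsto_levelAvg hab),
      ae_restrict_mem measurableSet_Ioc] with x hx hxm
    have hc : Continuous fun y : ℝ => ENNReal.ofReal (y * log y + 1) :=
      ENNReal.continuous_ofReal.comp (Real.continuous_mul_log.add continuous_const)
    exact ((hc.tendsto (w x)).comp (hx hxm.1.le)).liminf_eq.symm
  have hfatou : ∫⁻ x in Set.Ioc a b, ENNReal.ofReal (w x * log (w x) + 1) ≤
      ENNReal.ofReal (B + (b - a)) := by
    rw [lintegral_congr_ae hlim]
    refine (lintegral_liminf_le fun n => ?_).trans ?_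
    · exact (((Real.continuous_mul_log.measurable.comp
        (measurable_levelAvg w a b n)).add_const 1).ennreal_ofReal)
    · exact (Filter.liminf_le_liminf (Filter.Eventually.of_forall hlevel)).trans_eq
        (Filter.liminf_const _)
  have h3 := hi.add (intervalIntegrable_const (c := (1 : ℝ)))
  rw [← ofReal_integral_eq_lintegral_ofReal h3.1 (ae_restrict_of_ae (hw.2.mono fun x hx => by
      have := neg_one_le_mul_log hx
      simp only [Pi.zero_apply]
      linarith)), ← intervalIntegral.integral_of_le hab.le,
    intervalIntegral.integral_add hi intervalIntegrable_const, intervalIntegral.integral_const,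
    smul_eq_mul, mul_one] at hfatou
  have hB0 : 0 ≤ B + (b - a) := by
    have h0 : 0 ≤ ∫ x in a..b, (levelAvg w a b 0 x * log (levelAvg w a b 0 x) + 1) :=
      intervalIntegral.integral_nonneg hab.le fun x _ => hpos 0 x
    obtain ⟨h1, h2⟩ := integral_levelAvg_mul_log hab w 0
    rw [intervalIntegral.integral_add h1 intervalIntegrable_const, h2,
      intervalIntegral.integral_const, smul_eq_mul, mul_one] at h0
    linarith [hB 0]
  linarith [(ENNReal.ofReal_le_ofReal_iff hB0).1 hfatou]

/-- Theorem II.6, case `A(x) = x log x`. -/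
theorem buckleySum_comparable_xlogx :
    ∃ c C : ℝ, 0 < c ∧ 0 < C ∧ ∀ w : ℝ → ℝ, IsWeight w → ∀ a b : ℝ, a < b →
      IntervalIntegrable (fun x => w x * Real.log (w x)) volume a b →
      c * (avg (fun x => w x * Real.log (w x)) a b - avg w a b * Real.log (avg w a b)) ≤
          buckleySum w a b (fun x => x) ∧
        buckleySum w a b (fun x => x) ≤
          C * (avg (fun x => w x * Real.log (w x)) a b - avg w a b * Real.log (avg w a b)) := by
  refine ⟨4, 24, by norm_num, by norm_num, fun w hw a b hab hi => ?_⟩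
  have hl : 0 < b - a := sub_pos.2 hab
  have hB : ∀ n, ∑ i ∈ Finset.range n, buckleyLevel w a b i ≤
      24 * ((∫ x in a..b, w x * log (w x)) - levelSum w a b 0) := fun n =>
    (hw.sum_buckleyLevel_bounds hab n).2.trans (by linarith [hw.levelSum_le hab hi n])
  have hs : Summable (buckleyLevel w a b) :=
    summable_of_sum_range_le (hw.buckleyLevel_nonneg hab) hB
  have upper := hs.tsum_le_of_sum_range_le hB
  have lower : ∫ x in a..b, w x * log (w x) ≤
      levelSum w a b 0 + (∑' n, buckleyLevel w a b n) / 4 :=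
    hw.integral_mul_log_le hab hi fun n => by
      linarith [(hw.sum_buckleyLevel_bounds hab n).1,
        hs.sum_le_tsum (Finset.range n) fun i _ => hw.buckleyLevel_nonneg hab i]
  have gap : avg (fun x => w x * Real.log (w x)) a b - avg w a b * Real.log (avg w a b) =
      (b - a)⁻¹ * ((∫ x in a..b, w x * log (w x)) - levelSum w a b 0) := by
    have hav : avg (fun x => w x * log (w x)) a b = (b - a)⁻¹ * ∫ x in a..b, w x * log (w x) := rfl
    rw [levelSum_zero, hav]
    field_simp
  have sum_eq : buckleySum w a b (fun x => x) = (b - a)⁻¹ * ∑' n, buckleyLevel w a b n := rfl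
  rw [gap, sum_eq, mul_left_comm 4, mul_left_comm 24]
  exact ⟨mul_le_mul_of_nonneg_left (by linarith) (inv_nonneg.2 hl.le),
    mul_le_mul_of_nonneg_left upper (inv_nonneg.2 hl.le)⟩
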